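/- For every σ ∈ {1,…,n−1}, every i ∈ {1,…,n−σ}, every smooth curve Q = (q_1,…,q_{n+1}) : ℝ → ℝ^{n+1} with q_{n+1} nowhere zero, and every x ∈ ℝ: E_i(L^{n+1,n+1−σ,−n−1})[Q](x) = E_i(L^{n,n−σ,−n})[(q_1,…,q_{n−i}, q_{n−i+2},…,q_{n+1})](x); that is, the i-th Euler–Lagrange expression of the (n+1)-variable density equals the i-th Euler–Lagrange expression of the n-variable density evaluated on the curve obtained from Q by the partial shift q_j → q_{j+1} for j = n−i+1,…,n. -/

import Mathlib

open scoped BigOperators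

/-- Coordinate of `q` with the conventions `q₀ = 1` and `q_α = 0` for `α < 0` or `α > n`
(1-based indexing by an integer). -/
def qc (n : ℕ) (q : Fin n → ℝ) (r : ℤ) : ℝ :=
  if r = 0 then 1
  else if h : 1 ≤ r ∧ r ≤ (n : ℤ) then q ⟨(r - 1).toNat, by omega⟩ else 0

/-- The Benenti potentials `V_r^{(k)}` in `n` variables. -/
noncomputable def benenti (n : ℕ) (r k : ℤ) (q : Fin n → ℝ) : ℝ :=
  if r < 1 ∨ (n : ℤ) < r then 0
  else if k = 0 then (if r = (n : ℤ) then 1 else 0)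
  else if 0 < k then
    benenti n (r + 1) (k - 1) q - qc n q r * benenti n 1 (k - 1) q
  else
    benenti n (r - 1) (k + 1) q - (qc n q (r - 1) / qc n q n) * benenti n n (k + 1) q
termination_by k.natAbs
decreasing_by all_goals omega

/-- Partial derivative of `f` with respect to the `i`-th coordinate at `q`. -/
noncomputable def pd {n : ℕ} (f : (Fin n → ℝ) → ℝ) (i : Fin n) (q : Fin n → ℝ) : ℝ :=
  deriv (fun t => f (Function.update q i t)) (q i)

/-- Euler–Lagrange expression `E_l(L)[c](x)` of a Lagrangian density `L(q,p)`
along a curve `c`. -/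
noncomputable def elExpr {n : ℕ} (L : (Fin n → ℝ) → (Fin n → ℝ) → ℝ) (l : Fin n)
    (c : ℝ → Fin n → ℝ) (x : ℝ) : ℝ :=
  pd (fun vq => L vq (deriv c x)) l (c x)
    - deriv (fun y => pd (fun vp => L (c y) vp) l (deriv c y)) x

/-- The Lagrangian density `L^{n,m,k}`. -/
noncomputable def lag (n : ℕ) (m k : ℤ) (q p : Fin n → ℝ) : ℝ :=
  (1 / 2) * ∑ i : Fin n, ∑ j : Fin n,
      benenti n 1 (2 * (n : ℤ) - m - ((i : ℕ) + 1) - ((j : ℕ) + 1)) q * p i * p j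
    - benenti n 1 k q

/-- The matrix `L` of the Benenti class in Viète coordinates. -/
def Lmat (n : ℕ) (q : Fin n → ℝ) : Matrix (Fin n) (Fin n) ℝ :=
  Matrix.of fun i j => if (j : ℕ) = 0 then -q i else if (j : ℕ) = (i : ℕ) + 1 then 1 else 0


/-- integer-indexed coefficient -/
noncomputable def cz (φ : PowerSeries ℝ) (N : ℤ) : ℝ :=
  if N < 0 then 0 else PowerSeries.coeff N.toNat φ

lemma cz_neg (φ : PowerSeries ℝ) (N : ℤ) (h : N < 0) : cz φ N = 0 := by simp [cz, h]

lemma cz_nat (φ : PowerSeries ℝ) (N : ℕ) : cz φ N = PowerSeries.coeff N φ := by simp [cz]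

/-- inverse series -/
noncomputable def iv (u : ℕ → ℝ) : PowerSeries ℝ := (PowerSeries.mk u)⁻¹

lemma mul_iv (u : ℕ → ℝ) (h : u 0 ≠ 0) : PowerSeries.mk u * iv u = 1 := by
  apply PowerSeries.mul_inv_cancel
  simpa using h

lemma coeff_iv_congr (u v : ℕ → ℝ) (N : ℕ) :
    (∀ j ≤ N, u j = v j) → PowerSeries.coeff N (iv u) = PowerSeries.coeff N (iv v) := by
  induction N using Nat.strong_induction_on with
  | _ N ih =>
    intro h
    unfold iv at ih ⊢
    rw [PowerSeries.coeff_inv, PowerSeries.coeff_inv]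
    have h0 := h 0 (Nat.zero_le _)
    simp only [← PowerSeries.coeff_zero_eq_constantCoeff_apply, PowerSeries.coeff_mk, h0]
    congr 1
    congr 1
    apply Finset.sum_congr rfl
    intro x hx
    have := Finset.HasAntidiagonal.mem_antidiagonal.1 hx
    split_ifs with hl
    · rw [h x.1 (by omega), ih x.2 hl (fun j hj => h j (by omega))]
    · rfl

lemma cz_iv_congr (u v : ℕ → ℝ) (N : ℤ) (h : ∀ j : ℕ, (j : ℤ) ≤ N → u j = v j) :
    cz (iv u) N = cz (iv v) N := by
  unfold cz
  split_ifs with h0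
  · rfl
  · exact coeff_iv_congr _ _ _ (fun j hj => h j (by omega))

lemma cz_iv2_congr (u v : ℕ → ℝ) (N : ℤ) (h : ∀ j : ℕ, (j : ℤ) ≤ N → u j = v j) :
    cz (iv u * iv u) N = cz (iv v * iv v) N := by
  unfold cz
  split_ifs with h0
  · rfl
  · rw [PowerSeries.coeff_mul, PowerSeries.coeff_mul]
    apply Finset.sum_congr rfl
    intro x hx
    have := Finset.HasAntidiagonal.mem_antidiagonal.1 hx
    rw [coeff_iv_congr u v x.1 (fun j hj => h j (by omega)),
      coeff_iv_congr u v x.2 (fun j hj => h j (by omega))]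

lemma diff_coeff_iv (u : ℕ → ℝ) (h : u 0 ≠ 0) (b : ℕ) (hb : 1 ≤ b) (N : ℕ) :
    Differentiable ℝ (fun t => PowerSeries.coeff N (iv (Function.update u b t))) := by
  induction N using Nat.strong_induction_on with
  | _ N ih =>
    unfold iv at ih ⊢
    have hrw : ∀ t, PowerSeries.coeff N (PowerSeries.mk (Function.update u b t))⁻¹ = _ :=
      fun t => PowerSeries.coeff_inv N _
    rw [funext hrw]
    have h0 : ∀ t, Function.update u b t 0 = u 0 := fun t => by
      rw [Function.update_of_ne (by omega)]
    simp only [← PowerSeries.coeff_zero_eq_constantCoeff_apply, PowerSeries.coeff_mk, h0]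
    split_ifs with hN
    · fun_prop
    · apply Differentiable.const_mul
      apply Differentiable.fun_sum
      intro x hx
      split_ifs with hl
      · apply Differentiable.mul
        · by_cases hx : x.1 = b
          · simp only [hx, Function.update_self]; fun_prop
          · simp only [Function.update_of_ne hx]; fun_prop
        · exact ih _ hl
      · fun_prop

lemma hasDeriv_cz (u : ℕ → ℝ) (h : u 0 ≠ 0) (b : ℕ) (hb : 1 ≤ b) (N : ℤ) :
    HasDerivAt (fun t => cz (iv (Function.update u b t)) N) (-(cz (iv u * iv u) (N - b))) (u b) := by
  set D : PowerSeries ℝ := PowerSeries.mk (fun N =>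
    deriv (fun t => PowerSeries.coeff N (iv (Function.update u b t))) (u b)) with hD
  have key : PowerSeries.X ^ b * iv u + PowerSeries.mk u * D = 0 := by
    ext N
    have h1 : ∀ t, ∑ x ∈ Finset.HasAntidiagonal.antidiagonal N, (Function.update u b t x.1) *
        PowerSeries.coeff x.2 (iv (Function.update u b t)) = PowerSeries.coeff N (1 : PowerSeries ℝ) := by
      intro t
      rw [← mul_iv (Function.update u b t) (by rwa [Function.update_of_ne (by omega)]),
        PowerSeries.coeff_mul]
      simp
    have h2 : HasDerivAt (fun t => ∑ x ∈ Finset.HasAntidiagonal.antidiagonal N, (Function.update u b t x.1) *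
        PowerSeries.coeff x.2 (iv (Function.update u b t)))
        (∑ x ∈ Finset.HasAntidiagonal.antidiagonal N, ((if x.1 = b then 1 else 0) * PowerSeries.coeff x.2 (iv u)
          + u x.1 * PowerSeries.coeff x.2 D)) (u b) := by
      apply HasDerivAt.fun_sum
      intro x hx
      have ha : HasDerivAt (fun t => Function.update u b t x.1) (if x.1 = b then 1 else 0) (u b) := by
        by_cases hx : x.1 = b
        · simp only [hx, Function.update_self]; simpa using hasDerivAt_id' (u b)
        · simp only [Function.update_of_ne hx]; simpa [hx] using hasDerivAt_const (u b) (u x.1)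
      have hb := (diff_coeff_iv u h b hb x.2 (u b)).hasDerivAt
      have := ha.fun_mul hb
      simp only [Function.update_eq_self] at this
      rw [hD, PowerSeries.coeff_mk]
      exact this
    have h3 := h2.deriv
    simp only [h1, deriv_const] at h3
    rw [map_add, PowerSeries.coeff_mul, PowerSeries.coeff_mul, map_zero, ← Finset.sum_add_distrib, h3]
    apply Finset.sum_congr rfl
    intro x hx
    simp [PowerSeries.coeff_X_pow]
  have hDe : D = -(PowerSeries.X ^ b * (iv u * iv u)) := by
    have : iv u * (PowerSeries.mk u * D) = - (iv u * (PowerSeries.X ^ b * iv u)) := by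
      rw [eq_neg_of_add_eq_zero_right key]; ring
    rw [← mul_assoc, mul_comm (iv u) (PowerSeries.mk u), mul_iv u h, one_mul] at this
    rw [this]; ring
  by_cases hN : N < 0
  · simp only [cz_neg _ _ hN]
    rw [cz_neg _ _ (by omega)]
    simpa using hasDerivAt_const (u b) (0 : ℝ)
  · obtain ⟨M, rfl⟩ := Int.eq_ofNat_of_zero_le (not_lt.1 hN)
    simp only [cz_nat]
    have hd := (diff_coeff_iv u h b hb M (u b)).hasDerivAt
    have : deriv (fun t => PowerSeries.coeff M (iv (Function.update u b t))) (u b)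
      = PowerSeries.coeff M D := by simp [hD]
    rw [this, hDe, map_neg, PowerSeries.coeff_X_pow_mul'] at hd
    split_ifs at hd with hle
    · rw [← Nat.cast_sub hle, cz_nat]; exact hd
    · rw [cz_neg _ _ (by omega)]; exact hd

lemma rec_cz (u : ℕ → ℝ) (h : u 0 ≠ 0) (n : ℕ) (hu : ∀ j, n < j → u j = 0) (N : ℤ) :
    ∑ j ∈ Finset.range (n + 1), u j * cz (iv u) (N - j) = if N = 0 then 1 else 0 := by
  by_cases hN : N < 0
  · rw [if_neg (by omega)]
    apply Finset.sum_eq_zero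
    intro j _
    rw [cz_neg _ _ (by omega), mul_zero]
  · obtain ⟨M, rfl⟩ := Int.eq_ofNat_of_zero_le (not_lt.1 hN)
    have h1 : ∑ j ∈ Finset.range (M + 1), u j * cz (iv u) ((M : ℤ) - j) = if (M : ℤ) = 0 then 1 else 0 := by
      have := congrArg (PowerSeries.coeff M) (mul_iv u h)
      rw [PowerSeries.coeff_mul, Finset.Nat.sum_antidiagonal_eq_sum_range_succ_mk,
        PowerSeries.coeff_one] at this
      simp only [Nat.cast_eq_zero]
      rw [← this]
      apply Finset.sum_congr rfl
      intro j hj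
      have := Finset.mem_range.1 hj
      rw [← Nat.cast_sub (by omega), cz_nat]
      simp
    rw [← h1]
    have e1 : ∑ j ∈ Finset.range (n + 1), u j * cz (iv u) ((M : ℤ) - j)
        = ∑ j ∈ Finset.range (n + M + 1), u j * cz (iv u) ((M : ℤ) - j) := by
      apply Finset.sum_subset
      · intro j; simp; omega
      · intro j _ hj
        simp at hj
        rw [hu j (by omega), zero_mul]
    have e2 : ∑ j ∈ Finset.range (M + 1), u j * cz (iv u) ((M : ℤ) - j)
        = ∑ j ∈ Finset.range (n + M + 1), u j * cz (iv u) ((M : ℤ) - j) := by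
      apply Finset.sum_subset
      · intro j; simp; omega
      · intro j _ hj
        simp at hj
        rw [cz_neg _ _ (by omega), mul_zero]
    exact e1.trans e2.symm

/-- ascending coefficients -/
noncomputable def up (n : ℕ) (q : Fin n → ℝ) (j : ℕ) : ℝ := qc n q j

/-- descending coefficients -/
noncomputable def dn (n : ℕ) (q : Fin n → ℝ) (j : ℕ) : ℝ := qc n q ((n : ℤ) - j)

/-- closed form -/
noncomputable def av (n : ℕ) (q : Fin n → ℝ) (k : ℤ) : ℝ :=
  cz (iv (up n q)) (k - n + 1) - cz (iv (dn n q)) (-1 - k)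

lemma av_rec (n : ℕ) (hn : 1 ≤ n) (q : Fin n → ℝ) (hq : qc n q n ≠ 0) (k : ℤ) :
    ∑ j ∈ Finset.range (n + 1), qc n q j * av n q (k - j) = 0 := by
  have h1 := rec_cz (up n q) (by simp [up, qc]) n
    (fun j hj => by unfold up qc; rw [if_neg (by omega), dif_neg (by omega)]) (k - n + 1)
  have h2 := rec_cz (dn n q) (by simpa [dn] using hq) n
    (fun j hj => by unfold dn qc; rw [if_neg (by omega), dif_neg (by omega)]) (n - 1 - k)
  rw [← Finset.sum_range_reflect] at h2
  have h3 : ∑ j ∈ Finset.range (n + 1), qc n q j * av n q (k - j) =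
    (if k - n + 1 = 0 then (1 : ℝ) else 0) - (if (n : ℤ) - 1 - k = 0 then 1 else 0) := by
    rw [← h1, ← h2, ← Finset.sum_sub_distrib]
    apply Finset.sum_congr rfl
    intro j hj
    have hj := Finset.mem_range.1 hj
    unfold av up dn
    have e1 : (n : ℤ) - ((n + 1 - 1 - j : ℕ) : ℤ) = j := by omega
    rw [e1]
    rw [show k - n + 1 - (j : ℤ) = k - j - n + 1 by ring,
      show (n : ℤ) - 1 - k - ((n + 1 - 1 - j : ℕ) : ℤ) = -1 - (k - j) by omega]
    ring
  rw [h3]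
  by_cases hk : k - n + 1 = 0
  · rw [if_pos hk, if_pos (by omega), sub_self]
  · rw [if_neg hk, if_neg (by omega), sub_self]

/-- partial sums -/
noncomputable def bv (n : ℕ) (q : Fin n → ℝ) (r : ℕ) (k : ℤ) : ℝ :=
  ∑ j ∈ Finset.range r, qc n q j * av n q (k + r - 1 - j)

lemma bv_succ (n : ℕ) (q : Fin n → ℝ) (r : ℕ) (k : ℤ) :
    bv n q (r + 1) k = bv n q r (k + 1) + qc n q r * av n q k := by
  unfold bv
  rw [Finset.sum_range_succ]
  push_cast
  congr 1
  · apply Finset.sum_congr rfl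
    intro j _
    congr 2; ring
  · congr 2; ring

lemma bv_top (n : ℕ) (hn : 1 ≤ n) (q : Fin n → ℝ) (hq : qc n q n ≠ 0) (k : ℤ) :
    bv n q (n + 1) k = 0 := by
  unfold bv
  rw [← av_rec n hn q hq (k + n)]
  apply Finset.sum_congr rfl
  intro j _
  congr 2; push_cast; ring

lemma bv_zero (n : ℕ) (hn : 1 ≤ n) (q : Fin n → ℝ) (r : ℕ) (h1 : 1 ≤ r) (h2 : r ≤ n) :
    bv n q r 0 = if r = n then 1 else 0 := by
  unfold bv
  obtain ⟨r, rfl⟩ : ∃ s, r = s + 1 := ⟨r - 1, by omega⟩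
  rw [Finset.sum_range_succ', Finset.sum_eq_zero]
  · simp only [av]
    rw [cz_neg (iv (dn n q)) _ (by push_cast; omega)]
    have hq0 : qc n q ((0 : ℕ) : ℤ) = 1 := by simp [qc]
    rw [hq0]
    split_ifs with h
    · subst h
      have : (0 : ℤ) + ((r + 1 : ℕ) : ℤ) - 1 - ((0 : ℕ) : ℤ) - ((r + 1 : ℕ) : ℤ) + 1 = (0 : ℕ) := by
        push_cast; ring
      rw [this, cz_nat]
      simp [iv, up, qc]
    · rw [cz_neg _ _ (by push_cast; omega)]; simp
  · intro j hj
    have hj := Finset.mem_range.1 hj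
    simp only [av]
    rw [cz_neg _ _ (by push_cast; omega), cz_neg _ _ (by push_cast; omega)]
    simp

lemma benenti_out (n : ℕ) (r k : ℤ) (q : Fin n → ℝ) (h : r < 1 ∨ (n : ℤ) < r) :
    benenti n r k q = 0 := by
  rw [benenti, if_pos h]

lemma benenti_eq (n : ℕ) (hn : 1 ≤ n) (q : Fin n → ℝ) (hq : qc n q n ≠ 0) (M : ℕ) :
    ∀ (k : ℤ), k.natAbs = M → ∀ (r : ℕ), r ≤ n + 1 → (1 ≤ r ∧ r ≤ n → benenti n r k q = bv n q r k) ∧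
      benenti n r k q = bv n q r k := by
  induction M using Nat.strong_induction_on with
  | _ M ih =>
    intro k hk r hr
    suffices h : 1 ≤ r ∧ r ≤ n → benenti n r k q = bv n q r k by
      refine ⟨h, ?_⟩
      by_cases h1 : 1 ≤ r ∧ r ≤ n
      · exact h h1
      · rw [benenti_out n r k q (by omega)]
        rcases (show r = 0 ∨ r = n + 1 by omega) with rfl | rfl
        · simp [bv]
        · rw [bv_top n hn q hq]
    · rintro ⟨h1, h2⟩
      rw [benenti, if_neg (by omega)]
      split_ifs with hk0 hr hkp
      · subst hk0; rw [bv_zero n hn q r h1 h2, if_pos (by omega)]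
      · subst hk0; rw [bv_zero n hn q r h1 h2, if_neg (by omega)]
      · have e1 := (ih _ (by omega) (k - 1) rfl (r + 1) (by omega)).2
        have e2 := (ih _ (by omega) (k - 1) rfl 1 (by omega)).2
        push_cast at e1 e2
        rw [e1, e2, bv_succ, bv_succ n q 0]
        simp [bv, qc]
      · obtain ⟨r, rfl⟩ : ∃ s, r = s + 1 := ⟨r - 1, by omega⟩
        have e1 := (ih _ (by omega) (k + 1) rfl r (by omega)).2
        have e2 := (ih _ (by omega) (k + 1) rfl n (by omega)).2
        push_cast
        rw [add_sub_cancel_right, e1, e2, bv_succ]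
        have := bv_top n hn q hq k
        rw [bv_succ] at this
        rw [eq_neg_of_add_eq_zero_left this]
        field_simp
        ring

lemma benenti_one (n : ℕ) (hn : 1 ≤ n) (q : Fin n → ℝ) (hq : qc n q n ≠ 0) (k : ℤ) :
    benenti n 1 k q = av n q k := by
  have := (benenti_eq n hn q hq _ k rfl 1 (by omega)).2
  push_cast at this
  rw [this]; simp [bv, qc]

lemma qc_update (n : ℕ) (q : Fin n → ℝ) (l : Fin n) (t : ℝ) (r : ℤ) :
    qc n (Function.update q l t) r = if r = (l : ℕ) + 1 then t else qc n q r := by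
  have hl := l.2
  unfold qc
  by_cases h : r = (l : ℕ) + 1
  · rw [if_pos h, if_neg (by omega), dif_pos (by omega)]
    have : (⟨(r - 1).toNat, by omega⟩ : Fin n) = l := by apply Fin.ext; simp; omega
    rw [this, Function.update_self]
  · rw [if_neg h]
    split_ifs with h1 h2
    · rfl
    · rw [Function.update_of_ne]
      intro h3
      apply h
      have := congrArg Fin.val h3
      simp at this
      omega
    · rfl

lemma up_update (n : ℕ) (q : Fin n → ℝ) (l : Fin n) (t : ℝ) :
    up n (Function.update q l t) = Function.update (up n q) (l + 1) t := by
  funext j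
  unfold up
  rw [qc_update, Function.update_apply]
  by_cases h : j = (l : ℕ) + 1
  · rw [if_pos h, if_pos (by omega)]
  · rw [if_neg h, if_neg (by omega)]

lemma dn_update (n : ℕ) (q : Fin n → ℝ) (l : Fin n) (t : ℝ) :
    dn n (Function.update q l t) = Function.update (dn n q) (n - (l + 1)) t := by
  funext j
  have hl := l.2
  unfold dn
  rw [qc_update, Function.update_apply]
  by_cases h : j = n - ((l : ℕ) + 1)
  · rw [if_pos h, if_pos (by omega)]
  · rw [if_neg h, if_neg (by omega)]

lemma qc_fin (n : ℕ) (q : Fin n → ℝ) (l : Fin n) : qc n q ((l : ℕ) + 1) = q l := by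
  have hl := l.2
  unfold qc
  rw [if_neg (by omega), dif_pos (by omega)]
  congr 1
  apply Fin.ext; simp

/-- derivative of the potential -/
noncomputable def dv (n : ℕ) (q : Fin n → ℝ) (l : ℕ) (k : ℤ) : ℝ :=
  -cz (iv (up n q) * iv (up n q)) (k - n - l) + cz (iv (dn n q) * iv (dn n q)) (l - n - k)

lemma hasDeriv_benenti (n : ℕ) (q : Fin n → ℝ) (hq : qc n q n ≠ 0) (l : Fin n) (hl : (l : ℕ) + 1 < n)
    (k : ℤ) :
    HasDerivAt (fun t => benenti n 1 k (Function.update q l t)) (dv n q l k) (q l) := by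
  have h0 : ∀ t, benenti n 1 k (Function.update q l t) =
      cz (iv (Function.update (up n q) (l + 1) t)) (k - n + 1)
       - cz (iv (Function.update (dn n q) (n - (l + 1)) t)) (-1 - k) := by
    intro t
    rw [benenti_one n (by omega) _ (by rw [qc_update, if_neg (by omega)]; exact hq), av, up_update,
      dn_update]
  rw [funext h0]
  have h1 := hasDeriv_cz (up n q) (by simp [up, qc]) (l + 1) (by omega) (k - n + 1)
  have h2 := hasDeriv_cz (dn n q) (by simpa [dn] using hq) (n - (l + 1)) (by omega) (-1 - k)
  have e1 : up n q (l + 1) = q l := by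
    unfold up; push_cast; exact qc_fin n q l
  have e2 : dn n q (n - (l + 1)) = q l := by
    unfold dn
    rw [show (n : ℤ) - ((n - ((l : ℕ) + 1) : ℕ) : ℤ) = (l : ℕ) + 1 by omega]; exact qc_fin n q l
  rw [e1] at h1
  rw [e2] at h2
  have h3 := h1.fun_sub h2
  rw [show k - n + 1 - (((l : ℕ) + 1 : ℕ) : ℤ) = k - n - (l : ℕ) by push_cast; ring,
    show (-1 : ℤ) - k - ((n - ((l : ℕ) + 1) : ℕ) : ℤ) = (l : ℕ) - n - k by omega] at h3
  unfold dv
  rw [sub_neg_eq_add] at h3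
  exact h3

lemma pd_q (n : ℕ) (m k : ℤ) (q p : Fin n → ℝ) (hq : qc n q n ≠ 0) (l : Fin n)
    (hl : (l : ℕ) + 1 < n) :
    pd (fun vq => lag n m k vq p) l q = (1 / 2) * ∑ i : Fin n, ∑ j : Fin n,
      dv n q l (2 * (n : ℤ) - m - ((i : ℕ) + 1) - ((j : ℕ) + 1)) * p i * p j - dv n q l k := by
  unfold pd lag
  apply HasDerivAt.deriv
  apply HasDerivAt.fun_sub
  · apply HasDerivAt.const_mul
    apply HasDerivAt.fun_sum
    intro i _
    apply HasDerivAt.fun_sum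
    intro j _
    exact ((hasDeriv_benenti n q hq l hl _).mul_const _).mul_const _
  · exact hasDeriv_benenti n q hq l hl _

lemma pd_p (n : ℕ) (m k : ℤ) (q p : Fin n → ℝ) (l : Fin n) :
    pd (fun vp => lag n m k q vp) l p = ∑ j : Fin n,
      benenti n 1 (2 * (n : ℤ) - m - ((l : ℕ) + 1) - ((j : ℕ) + 1)) q * p j := by
  unfold pd lag
  have hu : ∀ i : Fin n, HasDerivAt (fun t => Function.update p l t i) (if i = l then 1 else 0) (p l) := by
    intro i
    by_cases hx : i = l
    · simp only [hx, Function.update_self]; simpa using hasDerivAt_id' (p l)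
    · simp only [Function.update_of_ne hx]; simpa [hx] using hasDerivAt_const (p l) (p i)
  have h1 : HasDerivAt (fun t => (1 / 2 : ℝ) * ∑ i : Fin n, ∑ j : Fin n,
      benenti n 1 (2 * (n : ℤ) - m - ((i : ℕ) + 1) - ((j : ℕ) + 1)) q * Function.update p l t i
        * Function.update p l t j - benenti n 1 k q)
      ((1 / 2 : ℝ) * ∑ i : Fin n, ∑ j : Fin n,
        ((benenti n 1 (2 * (n : ℤ) - m - ((i : ℕ) + 1) - ((j : ℕ) + 1)) q * (if i = l then 1 else 0)) * p j
        + benenti n 1 (2 * (n : ℤ) - m - ((i : ℕ) + 1) - ((j : ℕ) + 1)) q * p i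
          * (if j = l then 1 else 0))) (p l) := by
    apply HasDerivAt.sub_const
    apply HasDerivAt.const_mul
    apply HasDerivAt.fun_sum
    intro i _
    apply HasDerivAt.fun_sum
    intro j _
    have := ((hu i).const_mul
      (benenti n 1 (2 * (n : ℤ) - m - ((i : ℕ) + 1) - ((j : ℕ) + 1)) q)).fun_mul (hu j)
    simp only [Function.update_eq_self] at this
    exact this
  rw [h1.deriv]
  simp only [Finset.sum_add_distrib]
  rw [Finset.sum_comm]
  simp only [mul_ite, mul_one, mul_zero, ite_mul, zero_mul, Finset.sum_ite_eq', Finset.mem_univ, if_true]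
  have : ∀ j : Fin n, (2 * (n : ℤ) - m - ((j : ℕ) + 1) - ((l : ℕ) + 1)) =
    (2 * (n : ℤ) - m - ((l : ℕ) + 1) - ((j : ℕ) + 1)) := fun j => by ring
  simp only [this]
  ring

lemma el_eq (n : ℕ) (m k : ℤ) (l : Fin n) (hl : (l : ℕ) + 1 < n) (c : ℝ → Fin n → ℝ)
    (hc : ∀ y, qc n (c y) n ≠ 0) (x : ℝ) :
    elExpr (lag n m k) l c x =
      (1 / 2) * ∑ i : Fin n, ∑ j : Fin n,
      dv n (c x) l (2 * (n : ℤ) - m - ((i : ℕ) + 1) - ((j : ℕ) + 1)) * deriv c x i * deriv c x j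
        - dv n (c x) l k
      - deriv (fun y => ∑ j : Fin n,
        av n (c y) (2 * (n : ℤ) - m - ((l : ℕ) + 1) - ((j : ℕ) + 1)) * deriv c y j) x := by
  unfold elExpr
  rw [pd_q n m k _ _ (hc x) l hl]
  congr 2
  funext y
  rw [pd_p]
  simp only [benenti_one n (by omega) _ (hc y)]

/-- partial shift of a vector -/
def sh (n i : ℕ) (v : Fin (n + 1) → ℝ) (j : Fin n) : ℝ :=
  if (j : ℕ) + 1 ≤ n - i then v j.castSucc else v j.succ

lemma sum_up (n i : ℕ) (v : Fin (n + 1) → ℝ) (C : ℕ → ℝ) (hC : ∀ a, n - i < a + 1 → C a = 0) :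
    ∑ a : Fin (n + 1), C a * v a = ∑ a : Fin n, C a * sh n i v a := by
  rw [Fin.sum_univ_castSucc]
  simp only [Fin.val_last, Fin.val_castSucc]
  rw [hC n (by omega), zero_mul, add_zero]
  apply Finset.sum_congr rfl
  intro a _
  unfold sh
  split_ifs with h
  · rfl
  · rw [hC a (by omega), zero_mul, zero_mul]

lemma sum_dn (n i : ℕ) (v : Fin (n + 1) → ℝ) (C : ℕ → ℝ) (h0 : C 0 = 0)
    (hC : ∀ a, a + 1 ≤ n - i → C (a + 1) = 0) :
    ∑ a : Fin (n + 1), C a * v a = ∑ a : Fin n, C (a + 1) * sh n i v a := by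
  rw [Fin.sum_univ_succ]
  simp only [Fin.val_zero, Fin.val_succ]
  rw [h0, zero_mul, zero_add]
  apply Finset.sum_congr rfl
  intro a _
  unfold sh
  split_ifs with h
  · rw [hC a (by omega), zero_mul, zero_mul]
  · rfl

lemma sum_up2 (n i : ℕ) (v : Fin (n + 1) → ℝ) (C : ℕ → ℕ → ℝ)
    (hC : ∀ a b, n - i < a + 1 → C a b = 0) (hC' : ∀ a b, n - i < b + 1 → C a b = 0) :
    ∑ a : Fin (n + 1), ∑ b : Fin (n + 1), C a b * v a * v b
      = ∑ a : Fin n, ∑ b : Fin n, C a b * sh n i v a * sh n i v b := by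
  have e := sum_up n i v (fun a => ∑ b : Fin n, C a b * sh n i v b)
    (fun a ha => Finset.sum_eq_zero (fun b _ => by rw [hC a b ha, zero_mul]))
  simp only [Finset.sum_mul] at e
  calc _ = ∑ a : Fin (n + 1), (∑ b : Fin (n + 1), C a b * v b) * v a := by
        simp only [Finset.sum_mul]
        exact Finset.sum_congr rfl (fun a _ => Finset.sum_congr rfl (fun b _ => by ring))
    _ = ∑ a : Fin (n + 1), (∑ b : Fin n, C a b * sh n i v b) * v a :=
        Finset.sum_congr rfl (fun a _ => by rw [sum_up n i v (C a) (fun b hb => hC' a b hb)])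
    _ = _ := by
        simp only [Finset.sum_mul]
        rw [e]
        exact Finset.sum_congr rfl (fun a _ => Finset.sum_congr rfl (fun b _ => by ring))

lemma sum_dn2 (n i : ℕ) (v : Fin (n + 1) → ℝ) (C : ℕ → ℕ → ℝ)
    (h0 : ∀ b ≤ n, C 0 b = 0) (h0' : ∀ a ≤ n, C a 0 = 0)
    (hC : ∀ a, ∀ b ≤ n, a + 1 ≤ n - i → C (a + 1) b = 0)
    (hC' : ∀ a ≤ n, ∀ b, b + 1 ≤ n - i → C a (b + 1) = 0) :
    ∑ a : Fin (n + 1), ∑ b : Fin (n + 1), C a b * v a * v b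
      = ∑ a : Fin n, ∑ b : Fin n, C (a + 1) (b + 1) * sh n i v a * sh n i v b := by
  have e := sum_dn n i v (fun a => ∑ b : Fin n, C a (b + 1) * sh n i v b)
    (Finset.sum_eq_zero (fun b _ => by rw [h0 _ (by omega), zero_mul]))
    (fun a ha => Finset.sum_eq_zero (fun b _ => by rw [hC a _ (by omega) ha, zero_mul]))
  simp only [Finset.sum_mul] at e
  calc _ = ∑ a : Fin (n + 1), (∑ b : Fin (n + 1), C a b * v b) * v a := by
        simp only [Finset.sum_mul]
        exact Finset.sum_congr rfl (fun a _ => Finset.sum_congr rfl (fun b _ => by ring))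
    _ = ∑ a : Fin (n + 1), (∑ b : Fin n, C a (b + 1) * sh n i v b) * v a :=
        Finset.sum_congr rfl (fun a _ => by
          rw [sum_dn n i v (C a) (h0' a (by omega)) (fun b hb => hC' a (by omega) b hb)])
    _ = _ := by
        simp only [Finset.sum_mul]
        rw [e]
        exact Finset.sum_congr rfl (fun a _ => Finset.sum_congr rfl (fun b _ => by ring))

lemma up_sh (n i : ℕ) (v : Fin (n + 1) → ℝ) (j : ℕ) (hj : j ≤ n - i) :
    up (n + 1) v j = up n (sh n i v) j := by
  unfold up
  rcases Nat.eq_zero_or_pos j with rfl | h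
  · simp [qc]
  · obtain ⟨s, rfl⟩ : ∃ s, j = s + 1 := ⟨j - 1, by omega⟩
    have h1 := qc_fin (n + 1) v ⟨s, by omega⟩
    have h2 := qc_fin n (sh n i v) ⟨s, by omega⟩
    push_cast
    simp only at h1 h2
    rw [h1, h2, sh, if_pos (by simpa using hj)]
    rfl

lemma dn_sh (n i : ℕ) (hi : i ≤ n) (v : Fin (n + 1) → ℝ) (j : ℕ) (hj : j < i) :
    dn (n + 1) v j = dn n (sh n i v) j := by
  unfold dn
  obtain ⟨s, hs⟩ : ∃ s, n = j + s + 1 := ⟨n - j - 1, by omega⟩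
  have h1 := qc_fin (n + 1) v ⟨s + 1, by omega⟩
  have h2 := qc_fin n (sh n i v) ⟨s, by omega⟩
  simp only at h1 h2
  rw [show ((n + 1 : ℕ) : ℤ) - j = ((s + 1 : ℕ) : ℤ) + 1 by omega,
    show (n : ℤ) - j = (s : ℤ) + 1 by omega, h1, h2, sh, if_neg (by simp; omega)]
  rfl

lemma deriv_sh (n i : ℕ) (Q : ℝ → Fin (n + 1) → ℝ) (hQ : Differentiable ℝ Q) (y : ℝ) :
    deriv (fun y => sh n i (Q y)) y = sh n i (deriv Q y) := by
  have h := hasDerivAt_pi.1 (hQ y).hasDerivAt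
  apply HasDerivAt.deriv
  rw [hasDerivAt_pi]
  intro j
  unfold sh
  split_ifs
  · exact h _
  · exact h _

lemma av_sum (n σ i : ℕ) (hσ1 : 1 ≤ σ) (hσ2 : σ ≤ n - 1) (hi1 : 1 ≤ i) (hi2 : i ≤ n - σ)
    (q v : Fin (n + 1) → ℝ) :
    ∑ j : Fin (n + 1), av (n + 1) q
        (2 * ((n + 1 : ℕ) : ℤ) - (n + 1 - σ) - (((i - 1 : ℕ) : ℤ) + 1) - ((j : ℕ) + 1)) * v j
    = ∑ j : Fin n, av n (sh n i q)
        (2 * (n : ℤ) - (n - σ) - (((i - 1 : ℕ) : ℤ) + 1) - ((j : ℕ) + 1)) * sh n i v j := by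
  simp only [av, sub_mul, Finset.sum_sub_distrib]
  congr 1
  · rw [sum_up n i v (fun j => cz (iv (up (n + 1) q)) (2 * ((n + 1 : ℕ) : ℤ) - (n + 1 - σ)
      - (((i - 1 : ℕ) : ℤ) + 1) - ((j : ℕ) + 1) - ((n + 1 : ℕ) : ℤ) + 1))
      (fun a ha => cz_neg _ _ (by omega))]
    apply Finset.sum_congr rfl
    intro j _
    congr 1
    rw [cz_iv_congr _ _ _ (fun j' hj' => up_sh n i q j' (by omega))]
    congr 1
    omega
  · rw [sum_dn n i v (fun j => cz (iv (dn (n + 1) q)) (-1 - (2 * ((n + 1 : ℕ) : ℤ) - (n + 1 - σ)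
      - (((i - 1 : ℕ) : ℤ) + 1) - ((j : ℕ) + 1))))
      (cz_neg _ _ (by omega))
      (fun a ha => cz_neg _ _ (by omega))]
    apply Finset.sum_congr rfl
    intro j _
    congr 1
    rw [cz_iv_congr _ _ _ (fun j' hj' => dn_sh n i (by omega) q j' (by omega))]
    congr 1
    omega

lemma dv_sum (n σ i : ℕ) (hσ1 : 1 ≤ σ) (hσ2 : σ ≤ n - 1) (hi1 : 1 ≤ i) (hi2 : i ≤ n - σ)
    (q v : Fin (n + 1) → ℝ) :
    ∑ a : Fin (n + 1), ∑ b : Fin (n + 1), dv (n + 1) q (i - 1)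
        (2 * ((n + 1 : ℕ) : ℤ) - (n + 1 - σ) - ((a : ℕ) + 1) - ((b : ℕ) + 1)) * v a * v b
    = ∑ a : Fin n, ∑ b : Fin n, dv n (sh n i q) (i - 1)
        (2 * (n : ℤ) - (n - σ) - ((a : ℕ) + 1) - ((b : ℕ) + 1)) * sh n i v a * sh n i v b := by
  simp only [dv, add_mul, Finset.sum_add_distrib]
  congr 1
  · rw [sum_up2 n i v (fun a b => -cz (iv (up (n + 1) q) * iv (up (n + 1) q))
      (2 * ((n + 1 : ℕ) : ℤ) - (n + 1 - σ)
      - ((a : ℕ) + 1) - ((b : ℕ) + 1) - ((n + 1 : ℕ) : ℤ) - ((i - 1 : ℕ) : ℤ)))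
      (fun a b ha => by rw [cz_neg _ _ (by omega), neg_zero])
      (fun a b ha => by rw [cz_neg _ _ (by omega), neg_zero])]
    apply Finset.sum_congr rfl
    intro a _
    apply Finset.sum_congr rfl
    intro b _
    congr 3
    rw [cz_iv2_congr _ _ _ (fun j' hj' => up_sh n i q j' (by omega))]
    congr 1
    omega
  · rw [sum_dn2 n i v (fun a b => cz (iv (dn (n + 1) q) * iv (dn (n + 1) q))
      (((i - 1 : ℕ) : ℤ) - ((n + 1 : ℕ) : ℤ) - (2 * ((n + 1 : ℕ) : ℤ) - (n + 1 - σ)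
      - ((a : ℕ) + 1) - ((b : ℕ) + 1))))
      (fun b hb => cz_neg _ _ (by omega)) (fun b hb => cz_neg _ _ (by omega))
      (fun a b hb ha => cz_neg _ _ (by omega)) (fun a hb b ha => cz_neg _ _ (by omega))]
    apply Finset.sum_congr rfl
    intro a _
    apply Finset.sum_congr rfl
    intro b _
    congr 2
    rw [cz_iv2_congr _ _ _ (fun j' hj' => dn_sh n i (by omega) q j' (by omega))]
    congr 1
    omega

/-- for every `σ ∈ {1,…,n−1}`, `i ∈ {1,…,n−σ}`, every smooth curve
`Q = (q₁,…,q_{n+1})` with `q_{n+1}` nowhere zero, and every `x`: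
`E_i(L^{n+1,n+1−σ,−n−1})[Q](x)` equals the `i`-th Euler–Lagrange expression of the
`n`-variable density on the partially shifted curve `(q₁,…,q_{n−i},q_{n−i+2},…,q_{n+1})`. -/
theorem el_negative_stabilization
    (n : ℕ) (hn : 1 ≤ n) (σ : ℕ) (hσ1 : 1 ≤ σ) (hσ2 : σ ≤ n - 1)
    (i : ℕ) (hi1 : 1 ≤ i) (hi2 : i ≤ n - σ)
    (Q : ℝ → Fin (n + 1) → ℝ) (hQ : ContDiff ℝ (⊤ : ℕ∞) Q)
    (hn1 : ∀ x : ℝ, Q x ⟨n, by omega⟩ ≠ 0) (x : ℝ) :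
    elExpr (lag (n + 1) ((n : ℤ) + 1 - σ) (-(n : ℤ) - 1)) ⟨i - 1, by omega⟩ Q x
      = elExpr (lag n ((n : ℤ) - σ) (-(n : ℤ))) ⟨i - 1, by omega⟩
          (fun y j => if (j : ℕ) + 1 ≤ n - i then Q y j.castSucc else Q y j.succ) x := by
  have hd : Differentiable ℝ Q := hQ.differentiable (by simp)
  have hcQ : ∀ y, qc (n + 1) (Q y) ((n + 1 : ℕ) : ℤ) ≠ 0 := by
    intro y
    have := qc_fin (n + 1) (Q y) ⟨n, by omega⟩
    simp only at this
    push_cast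
    rw [this]; exact hn1 y
  have hcS : ∀ y, qc n (sh n i (Q y)) (n : ℤ) ≠ 0 := by
    intro y
    have h1 := dn_sh n i (by omega) (Q y) 0 (by omega)
    have h2 := hcQ y
    simp only [dn, Nat.cast_zero, sub_zero] at h1
    rwa [h1] at h2
  change _ = elExpr (lag n ((n : ℤ) - σ) (-(n : ℤ))) ⟨i - 1, by omega⟩
    (fun y => sh n i (Q y)) x
  rw [el_eq (n + 1) _ _ _ (by simp; omega) Q hcQ, el_eq n _ _ _ (by simp; omega) _ hcS]
  simp only [deriv_sh n i Q hd]
  have e1 := dv_sum n σ i hσ1 hσ2 hi1 hi2 (Q x) (deriv Q x)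
  have e2 : dv (n + 1) (Q x) (i - 1) (-(n : ℤ) - 1) = dv n (sh n i (Q x)) (i - 1) (-(n : ℤ)) := by
    unfold dv
    rw [cz_neg (iv (up (n + 1) (Q x)) * _) _ (by omega),
      cz_neg (iv (up n (sh n i (Q x))) * _) _ (by omega),
      cz_iv2_congr _ _ _ (fun j' hj' => dn_sh n i (by omega) (Q x) j' (by omega))]
    congr 2
    omega
  have e3 := fun y => av_sum n σ i hσ1 hσ2 hi1 hi2 (Q y) (deriv Q y)
  rw [e1, e2, funext e3]
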